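/- Let n = 1; let F : ℝ×ℝᵐ → ℝ be continuously differentiable, f, g three times continuously differentiable; assume inf-compactness at x̄. Suppose (x̄,ȳ) is a local minimizer of the bilevel program with no upper-level constraints, S(x̄) = {ȳ₁, ȳ₂} with ȳ = ȳ₁ ≠ ȳ₂, each ȳ_k is a nondegenerate critical point of L(x̄) (ND1–ND3) with (unique) multiplier ū^k satisfying ū^k_j > 0 for j ∈ J₀(x̄,ȳ_k), and there are C² maps y₁, y₂ on a neighborhood of x̄ with y_k(x̄) = ȳ_k such that every generalized critical point of L(x) near ȳ_k equals y_k(x), and α := (d/dx)[f(x,y₂(x)) − f(x,y₁(x))] at x = x̄ is nonzero. Set ū := ū¹ (extended by zero outside J₀(x̄,ȳ)). Then there exist λ₁, λ₂ ≥ 0 with λ₁ + λ₂ = 1, w ∈ ℝᵐ, ξ ∈ ℝᵖ, and μ > 0 such that: 0 = ∇_x F(x̄,ȳ) + μ Σ_{k=1}^2 λ_k (∇_x f(x̄,ȳ) − ∇_x f(x̄,ȳ_k) − Σ_j ū^k_j ∇_x g_j(x̄,ȳ_k)) − [∇²_{xy}(f + ūᵀg)(x̄,ȳ)]w + ∇_x(ξᵀg)(x̄,ȳ);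 0 = ∇_y F(x̄,ȳ) + μ∇_y f(x̄,ȳ) − [∇²_{yy}(f + ūᵀg)(x̄,ȳ)]w + ∇_y(ξᵀg)(x̄,ȳ); ξ_i = 0 for all i ∉ J₀(x̄,ȳ); and ⟨∇_y g_j(x̄,ȳ), w⟩ = 0 for all j ∈ J₀(x̄,ȳ). -/

import Mathlib

open scoped RealInnerProductSpace
open Topology

noncomputable section

/-- The lower-level feasible set `Y(x) = {y : g(x,y) ≤ 0}`. -/
def Yset {m p : ℕ} (g : ℝ × EuclideanSpace ℝ (Fin m) → Fin p → ℝ)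
    (x : ℝ) : Set (EuclideanSpace ℝ (Fin m)) :=
  {y | ∀ j, g (x, y) j ≤ 0}

/-- The lower-level solution set `S(x)`. -/
def Sset {m p : ℕ} (f : ℝ × EuclideanSpace ℝ (Fin m) → ℝ)
    (g : ℝ × EuclideanSpace ℝ (Fin m) → Fin p → ℝ)
    (x : ℝ) : Set (EuclideanSpace ℝ (Fin m)) :=
  {y | y ∈ Yset g x ∧ ∀ y' ∈ Yset g x, f (x, y) ≤ f (x, y')}

/-- The partial gradient `∇_y f (x,y)` (upper-level variable one-dimensional). -/
def gradY {m : ℕ} (f : ℝ × EuclideanSpace ℝ (Fin m) → ℝ)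
    (x : ℝ) (y : EuclideanSpace ℝ (Fin m)) : EuclideanSpace ℝ (Fin m) :=
  gradient (fun y' => f (x, y')) y

/-- The partial gradient `∇_y g_j (x,y)`. -/
def gradYg {m p : ℕ} (g : ℝ × EuclideanSpace ℝ (Fin m) → Fin p → ℝ)
    (x : ℝ) (y : EuclideanSpace ℝ (Fin m)) (j : Fin p) : EuclideanSpace ℝ (Fin m) :=
  gradient (fun y' => g (x, y') j) y

/-- The lower-level Lagrangian `f + ūᵀ g`. -/
def Lag {m p : ℕ} (f : ℝ × EuclideanSpace ℝ (Fin m) → ℝ)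
    (g : ℝ × EuclideanSpace ℝ (Fin m) → Fin p → ℝ) (u : Fin p → ℝ) :
    ℝ × EuclideanSpace ℝ (Fin m) → ℝ :=
  fun z => f z + ∑ j, u j * g z j

/-- The Hessian block `∇²_{yy}(f + ūᵀg)(x̄,ȳ)` as a continuous linear map. -/
def LagYY {m p : ℕ} (f : ℝ × EuclideanSpace ℝ (Fin m) → ℝ)
    (g : ℝ × EuclideanSpace ℝ (Fin m) → Fin p → ℝ) (u : Fin p → ℝ)
    (x : ℝ) (y : EuclideanSpace ℝ (Fin m)) :
    EuclideanSpace ℝ (Fin m) →L[ℝ] EuclideanSpace ℝ (Fin m) :=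
  fderiv ℝ (fun y' => gradY (Lag f g u) x y') y

/-- The mixed second-derivative block `∇²_{xy}(f + ūᵀg)(x̄,ȳ)` (a vector, since `n = 1`). -/
def LagMix {m p : ℕ} (f : ℝ × EuclideanSpace ℝ (Fin m) → ℝ)
    (g : ℝ × EuclideanSpace ℝ (Fin m) → Fin p → ℝ) (u : Fin p → ℝ)
    (x : ℝ) (y : EuclideanSpace ℝ (Fin m)) : EuclideanSpace ℝ (Fin m) :=
  deriv (fun x' => gradY (Lag f g u) x' y) x

/-- `y` is a generalized critical (g.c.) point of `L(x)`. -/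
def gcPoint {m p : ℕ} (f : ℝ × EuclideanSpace ℝ (Fin m) → ℝ)
    (g : ℝ × EuclideanSpace ℝ (Fin m) → Fin p → ℝ)
    (x : ℝ) (y : EuclideanSpace ℝ (Fin m)) : Prop :=
  (∀ j, g (x, y) j ≤ 0) ∧
    ∃ (u₀ : ℝ) (u : Fin p → ℝ), (u₀, u) ≠ 0 ∧
      (∀ j, g (x, y) j ≠ 0 → u j = 0) ∧
      u₀ • gradY f x y + ∑ j, u j • gradYg g x y j = 0


section helpers
variable {m p : ℕ}

lemma inner_gradY {h : ℝ × EuclideanSpace ℝ (Fin m) → ℝ} {x : ℝ} {y : EuclideanSpace ℝ (Fin m)}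
    (hd : DifferentiableAt ℝ h (x, y)) (v : EuclideanSpace ℝ (Fin m)) :
    ⟪gradY h x y, v⟫ = fderiv ℝ h (x, y) (0, v) := by
  have h1 : HasFDerivAt (fun y' => h (x, y'))
      ((fderiv ℝ h (x, y)).comp (ContinuousLinearMap.inr ℝ ℝ (EuclideanSpace ℝ (Fin m)))) y :=
    hd.hasFDerivAt.comp y (hasFDerivAt_prodMk_right x y)
  have h2 := toDual_gradient (𝕜 := ℝ) (f := fun y' => h (x, y')) (x := y)
  have h3 : ⟪gradY h x y, v⟫ = (InnerProductSpace.toDual ℝ _ (gradY h x y)) v := by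
    simp
  rw [h3, gradY, h2, h1.fderiv]
  simp

lemma gradY_eq {h : ℝ × EuclideanSpace ℝ (Fin m) → ℝ}
    (hd : Differentiable ℝ h) (z : ℝ × EuclideanSpace ℝ (Fin m)) :
    gradY h z.1 z.2 = (InnerProductSpace.toDual ℝ (EuclideanSpace ℝ (Fin m))).symm
      ((fderiv ℝ h z).comp (ContinuousLinearMap.inr ℝ ℝ (EuclideanSpace ℝ (Fin m)))) := by
  apply ext_inner_right ℝ
  intro v
  rw [inner_gradY (hd _)]
  simp

lemma contDiff_gradY {h : ℝ × EuclideanSpace ℝ (Fin m) → ℝ} (hh : ContDiff ℝ 2 h) :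
    ContDiff ℝ 1 (fun z : ℝ × EuclideanSpace ℝ (Fin m) => gradY h z.1 z.2) := by
  have : (fun z : ℝ × EuclideanSpace ℝ (Fin m) => gradY h z.1 z.2) = fun z =>
      (InnerProductSpace.toDual ℝ (EuclideanSpace ℝ (Fin m))).symm
      ((fderiv ℝ h z).comp (ContinuousLinearMap.inr ℝ ℝ (EuclideanSpace ℝ (Fin m)))) := by
    funext z
    exact gradY_eq (hh.differentiable (by norm_num)) z
  rw [this]
  apply (InnerProductSpace.toDual ℝ (EuclideanSpace ℝ (Fin m))).symm.contDiff.comp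
  exact (hh.fderiv_right (m := 1) (by norm_num)).clm_comp contDiff_const

lemma deriv_x {h : ℝ × EuclideanSpace ℝ (Fin m) → ℝ} {x : ℝ} {y : EuclideanSpace ℝ (Fin m)}
    (hd : DifferentiableAt ℝ h (x, y)) :
    deriv (fun x => h (x, y)) x = fderiv ℝ h (x, y) (1, 0) := by
  have h1 : HasDerivAt (fun x => (x, y)) ((1 : ℝ), (0 : EuclideanSpace ℝ (Fin m))) x :=
    (hasDerivAt_id x).prodMk (hasDerivAt_const x y)
  exact (hd.hasFDerivAt.comp_hasDerivAt x h1).deriv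

lemma hasDerivAt_curve {h : ℝ × EuclideanSpace ℝ (Fin m) → ℝ} {x : ℝ}
    {c : ℝ → EuclideanSpace ℝ (Fin m)} {c' : EuclideanSpace ℝ (Fin m)}
    (hc : HasDerivAt c c' x)
    (hd : DifferentiableAt ℝ h (x, c x)) :
    HasDerivAt (fun t => h (t, c t)) (deriv (fun t => h (t, c x)) x + ⟪gradY h x (c x), c'⟫) x := by
  have h1 : HasDerivAt (fun x => (x, c x)) ((1 : ℝ), c') x :=
    (hasDerivAt_id x).prodMk hc
  have h2 := hd.hasFDerivAt.comp_hasDerivAt x h1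
  rw [deriv_x hd, inner_gradY hd, ← map_add]
  have e : ((1 : ℝ), (0 : EuclideanSpace ℝ (Fin m))) + (0, c') = (1, c') := by simp
  rw [e]
  exact h2

lemma Lag_contDiff {f : ℝ × EuclideanSpace ℝ (Fin m) → ℝ}
    {g : ℝ × EuclideanSpace ℝ (Fin m) → Fin p → ℝ} {n : WithTop ℕ∞}
    (hf : ContDiff ℝ n f) (hg : ContDiff ℝ n g) (u : Fin p → ℝ) : ContDiff ℝ n (Lag f g u) := by
  unfold Lag
  refine hf.add (ContDiff.sum fun j _ => contDiff_const.mul (contDiff_pi.1 hg j))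

lemma gradYg_eq (g : ℝ × EuclideanSpace ℝ (Fin m) → Fin p → ℝ) (x : ℝ)
    (y : EuclideanSpace ℝ (Fin m)) (j : Fin p) :
    gradYg g x y j = gradY (fun z => g z j) x y := rfl

lemma gradY_comb {g : ℝ × EuclideanSpace ℝ (Fin m) → Fin p → ℝ}
    (hg : Differentiable ℝ g) (u : Fin p → ℝ) (x : ℝ) (y : EuclideanSpace ℝ (Fin m)) :
    gradY (fun z => ∑ j, u j * g z j) x y = ∑ j, u j • gradYg g x y j := by
  have hgj : ∀ j, Differentiable ℝ (fun z => g z j) := fun j => differentiable_pi.1 hg j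
  have hs : DifferentiableAt ℝ (fun z => ∑ j, u j * g z j) (x, y) :=
    DifferentiableAt.fun_sum fun j _ => (hgj j _).const_mul _
  apply ext_inner_right ℝ
  intro v
  rw [inner_gradY hs, sum_inner, fderiv_fun_sum fun j _ => (hgj j _).const_mul _]
  simp only [inner_smul_left, gradYg_eq, inner_gradY (hgj _ _)]
  simp only [sum_apply]
  refine Finset.sum_congr rfl fun j _ => ?_
  rw [fderiv_const_mul (hgj j _)]
  simp

lemma gradY_Lag {f : ℝ × EuclideanSpace ℝ (Fin m) → ℝ}
    {g : ℝ × EuclideanSpace ℝ (Fin m) → Fin p → ℝ}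
    (hf : Differentiable ℝ f) (hg : Differentiable ℝ g) (u : Fin p → ℝ) (x : ℝ)
    (y : EuclideanSpace ℝ (Fin m)) :
    gradY (Lag f g u) x y = gradY f x y + ∑ j, u j • gradYg g x y j := by
  have hgj : ∀ j, Differentiable ℝ (fun z => g z j) := fun j => differentiable_pi.1 hg j
  have hs : Differentiable ℝ (fun z => ∑ j, u j * g z j) := fun z =>
    DifferentiableAt.fun_sum fun j _ => (hgj j _).const_mul _
  rw [← gradY_comb hg]
  apply ext_inner_right ℝ
  intro v
  have : Lag f g u = fun z => f z + ∑ j, u j * g z j := rfl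
  rw [inner_add_left, inner_gradY (hf _), inner_gradY (hs _), this,
    inner_gradY ((hf _).fun_add (hs _)), fderiv_fun_add (hf _) (hs _)]
  rfl

lemma deriv_comb {g : ℝ × EuclideanSpace ℝ (Fin m) → Fin p → ℝ}
    (hg : Differentiable ℝ g) (u : Fin p → ℝ) (x : ℝ) (y : EuclideanSpace ℝ (Fin m)) :
    deriv (fun x => ∑ j, u j * g (x, y) j) x = ∑ j, u j * deriv (fun x => g (x, y) j) x := by
  have hgj : ∀ j, DifferentiableAt ℝ (fun x => g (x, y) j) x := by
    intro j
    have := differentiable_pi.1 hg j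
    fun_prop
  rw [deriv_fun_sum fun j _ => (hgj j).const_mul _]
  refine Finset.sum_congr rfl fun j _ => ?_
  rw [deriv_const_mul _ (hgj j)]

lemma LagYY_apply {f : ℝ × EuclideanSpace ℝ (Fin m) → ℝ}
    {g : ℝ × EuclideanSpace ℝ (Fin m) → Fin p → ℝ}
    (hf : ContDiff ℝ 3 f) (hg : ContDiff ℝ 3 g) (u : Fin p → ℝ) (x : ℝ)
    (y v : EuclideanSpace ℝ (Fin m)) :
    LagYY f g u x y v =
      fderiv ℝ (fun z : ℝ × EuclideanSpace ℝ (Fin m) => gradY (Lag f g u) z.1 z.2) (x, y) (0, v) := by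
  have hc := contDiff_gradY ((Lag_contDiff hf hg u).of_le (by norm_num : (2 : WithTop ℕ∞) ≤ 3))
  have h1 := (hc.differentiable (by norm_num) (x, y)).hasFDerivAt.comp y
    (hasFDerivAt_prodMk_right x y)
  unfold LagYY
  erw [h1.fderiv]
  simp

lemma LagMix_eq {f : ℝ × EuclideanSpace ℝ (Fin m) → ℝ}
    {g : ℝ × EuclideanSpace ℝ (Fin m) → Fin p → ℝ}
    (hf : ContDiff ℝ 3 f) (hg : ContDiff ℝ 3 g) (u : Fin p → ℝ) (x : ℝ)
    (y : EuclideanSpace ℝ (Fin m)) :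
    LagMix f g u x y =
      fderiv ℝ (fun z : ℝ × EuclideanSpace ℝ (Fin m) => gradY (Lag f g u) z.1 z.2) (x, y) (1, 0) := by
  have hc := contDiff_gradY ((Lag_contDiff hf hg u).of_le (by norm_num : (2 : WithTop ℕ∞) ≤ 3))
  have h1 : HasDerivAt (fun x => (x, y)) ((1 : ℝ), (0 : EuclideanSpace ℝ (Fin m))) x :=
    (hasDerivAt_id x).prodMk (hasDerivAt_const x y)
  exact ((hc.differentiable (by norm_num) (x, y)).hasFDerivAt.comp_hasDerivAt x h1).deriv

lemma LagYY_symm {f : ℝ × EuclideanSpace ℝ (Fin m) → ℝ}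
    {g : ℝ × EuclideanSpace ℝ (Fin m) → Fin p → ℝ}
    (hf : ContDiff ℝ 3 f) (hg : ContDiff ℝ 3 g) (u : Fin p → ℝ) (x : ℝ)
    (y v w : EuclideanSpace ℝ (Fin m)) :
    ⟪LagYY f g u x y v, w⟫ = ⟪LagYY f g u x y w, v⟫ := by
  have hL := (Lag_contDiff hf hg u).of_le (by norm_num : (2 : WithTop ℕ∞) ≤ 3)
  have hc := (contDiff_gradY hL).differentiable (by norm_num) (x, y)
  have hL1 : Differentiable ℝ (fderiv ℝ (Lag f g u)) :=
    (hL.fderiv_right (m := 1) (by norm_num)).differentiable (by norm_num)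
  have key : ∀ a b : EuclideanSpace ℝ (Fin m), ⟪LagYY f g u x y a, b⟫ =
      fderiv ℝ (fderiv ℝ (Lag f g u)) (x, y) (0, a) (0, b) := by
    intro a b
    rw [LagYY_apply hf hg]
    have e1 : (fun z : ℝ × EuclideanSpace ℝ (Fin m) => ⟪gradY (Lag f g u) z.1 z.2, b⟫) =
        fun z => fderiv ℝ (Lag f g u) z (0, b) := by
      funext z
      exact inner_gradY (hL.differentiable (by norm_num) _) b
    have h1 := (hc.hasFDerivAt.inner ℝ (hasFDerivAt_const b (x, y))).fderiv
    have h2 := ((hL1 (x, y)).hasFDerivAt.clm_apply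
      (hasFDerivAt_const ((0 : ℝ), b) (x, y))).fderiv
    rw [e1, h2] at h1
    have := congrArg (fun T => T (0, a)) h1
    simp at this
    exact this.symm
  rw [key, key]
  exact (hL.contDiffAt.isSymmSndFDerivAt (by simp)) _ _

lemma exists_dir {ι : Type*} {a : ι → EuclideanSpace ℝ (Fin m)}
    (ha : LinearIndependent ℝ a) : ∃ d, ∀ j, ⟪a j, d⟫ = (-1 : ℝ) := by
  let B := Module.Basis.span ha
  obtain ⟨φ, hφ⟩ := LinearMap.exists_extend (B.constr ℝ (fun _ => (-1 : ℝ)))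
  refine ⟨(InnerProductSpace.toDual ℝ _).symm (LinearMap.toContinuousLinearMap φ), fun j => ?_⟩
  rw [real_inner_comm]
  simp only [InnerProductSpace.toDual_symm_apply]
  have h1 : a j = (B j : EuclideanSpace ℝ (Fin m)) := by simp [B, Module.Basis.span_apply]
  have h2 := congrArg (fun T => T (B j)) hφ
  simp only [LinearMap.comp_apply, Module.Basis.constr_basis, Submodule.subtype_apply] at h2
  rw [h1]
  exact h2

lemma solve_w {ι : Type*} [Fintype ι] (a : ι → EuclideanSpace ℝ (Fin m))
    (H : EuclideanSpace ℝ (Fin m) →L[ℝ] EuclideanSpace ℝ (Fin m))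
    (hH : ∀ w, (∀ j, ⟪a j, w⟫ = 0) → (∀ v, (∀ j, ⟪a j, v⟫ = 0) → ⟪H w, v⟫ = 0) → w = 0)
    (b : EuclideanSpace ℝ (Fin m)) :
    ∃ w, ∃ ξ : ι → ℝ, (∀ j, ⟪a j, w⟫ = 0) ∧ b - H w + ∑ j, ξ j • a j = 0 := by
  let W := Submodule.span ℝ (Set.range a)
  have hT : ∀ w, w ∈ Wᗮ ↔ ∀ j, ⟪a j, w⟫ = 0 := by
    intro w
    constructor
    · intro h j
      exact h _ (Submodule.subset_span ⟨j, rfl⟩)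
    · intro h
      rw [Submodule.mem_orthogonal]
      intro u hu
      induction hu using Submodule.span_induction with
      | mem x hx => obtain ⟨j, rfl⟩ := hx; exact h j
      | zero => simp
      | add x y _ _ hx hy => simp [inner_add_left, hx, hy]
      | smul c x _ hx => simp [inner_smul_left, hx]
  let P : Wᗮ →ₗ[ℝ] Wᗮ := (Wᗮ.orthogonalProjectionOnto.toLinearMap).comp
    (H.toLinearMap.comp Wᗮ.subtype)
  have hP : ∀ (w v : Wᗮ), ⟪P w, v⟫ = ⟪H w, (v : EuclideanSpace ℝ (Fin m))⟫ := by
    intro w v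
    simp [P]
  have hinj : Function.Injective P := by
    rw [← LinearMap.ker_eq_bot, LinearMap.ker_eq_bot']
    intro w hw
    have := hH w ((hT _).1 w.2) (fun v hv => by
      have := hP w ⟨v, (hT v).2 hv⟩
      rw [hw] at this
      simpa using this.symm)
    exact Subtype.ext this
  obtain ⟨w, hw⟩ := (LinearMap.injective_iff_surjective.1 hinj) (Wᗮ.orthogonalProjectionOnto b)
  have hmem : H w - b ∈ W := by
    have hoo := Submodule.orthogonal_orthogonal W
    suffices h : H w - b ∈ Wᗮᗮ by
      rw [hoo] at h
      exact h
    rw [Submodule.mem_orthogonal']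
    intro v hv
    have h1 := hP w ⟨v, hv⟩
    rw [hw] at h1
    rw [inner_sub_left, ← h1]
    simp
  obtain ⟨ξ, hξ⟩ := (Submodule.mem_span_range_iff_exists_fun ℝ).1 hmem
  refine ⟨w, ξ, (hT _).1 w.2, ?_⟩
  rw [hξ]; abel

end helpers

section helpers2
variable {m p : ℕ}

open Classical in
lemma sum_sub {P : Fin p → Prop} (a : Fin p → EuclideanSpace ℝ (Fin m)) {u : Fin p → ℝ}
    (hu : ∀ j, ¬ P j → u j = 0) :
    ∑ j, u j • a j = ∑ i : {j // P j}, u i.1 • a i.1 := by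
  rw [← Finset.sum_subtype (Finset.univ.filter P) (by simp) (fun j => u j • a j)]
  rw [Finset.sum_filter]
  refine Finset.sum_congr rfl fun j _ => ?_
  split_ifs with h
  · rfl
  · simp [hu j h]

lemma exists_feasible {g : ℝ × EuclideanSpace ℝ (Fin m) → Fin p → ℝ}
    (hg : ContDiff ℝ 3 g) {xb : ℝ} {yb : EuclideanSpace ℝ (Fin m)}
    (hfeas : yb ∈ Yset g xb)
    (hLICQ : LinearIndependent ℝ
      (fun j : {j : Fin p // g (xb, yb) j = 0} => gradYg g xb yb j.1))
    {U : Set (ℝ × EuclideanSpace ℝ (Fin m))} (hU : U ∈ 𝓝 (xb, yb)) :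
    ∀ᶠ x in 𝓝 xb, ∃ y, (x, y) ∈ U ∧ y ∈ Yset g x := by
  obtain ⟨d, hd⟩ := exists_dir hLICQ
  have hgd : Differentiable ℝ g := hg.differentiable (by norm_num)
  have hgj : ∀ j, Differentiable ℝ (fun z => g z j) := fun j => differentiable_pi.1 hgd j
  have hct : Filter.Tendsto (fun t : ℝ => (xb, yb + t • d)) (𝓝[>] 0) (𝓝 (xb, yb)) := by
    have : Continuous (fun t : ℝ => (xb, yb + t • d)) := by fun_prop
    have h := this.tendsto 0
    simp only [zero_smul, add_zero] at h
    exact h.mono_left nhdsWithin_le_nhds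
  have hneg : ∀ j, ∀ᶠ t : ℝ in 𝓝[>] 0, g (xb, yb + t • d) j < 0 := by
    intro j
    rcases eq_or_lt_of_le (hfeas j) with h0 | h0
    · have hline : HasDerivAt (fun t : ℝ => (xb, yb + t • d)) ((0 : ℝ), d) 0 := by
        have := ((hasDerivAt_id (0 : ℝ)).smul_const d).const_add yb
        simp only [one_smul] at this
        exact (hasDerivAt_const (0 : ℝ) xb).prodMk this
      have hdg : HasFDerivAt (fun z => g z j) (fderiv ℝ (fun z => g z j) (xb, yb))
          (xb, yb + (0 : ℝ) • d) := by
        simpa using (hgj j (xb, yb)).hasFDerivAt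
      have hder := hdg.comp_hasDerivAt (0 : ℝ) hline
      have hv : fderiv ℝ (fun z => g z j) (xb, yb) (0, d) = -1 := by
        rw [← inner_gradY (hgj j _)]
        exact hd ⟨j, h0⟩
      rw [hv] at hder
      have hs := hder.tendsto_slope
      have hs2 : ∀ᶠ t : ℝ in 𝓝[>] 0, slope ((fun z => g z j) ∘ fun t : ℝ => (xb, yb + t • d)) 0 t < 0 :=
        (hs.mono_left (nhdsWithin_mono _ (fun t (ht : 0 < t) => ht.ne'))).eventually
          (gt_mem_nhds (by norm_num))
      filter_upwards [hs2, self_mem_nhdsWithin] with t ht ht0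
      have ht0' : (0 : ℝ) < t := ht0
      rw [slope_def_field] at ht
      simp only [Function.comp, zero_smul, add_zero, h0, sub_zero] at ht
      rcases div_neg_iff.1 ht with h | h
      · linarith [h.2]
      · exact h.1
    · exact (hct.eventually ((hgj j).continuous.continuousAt.eventually (gt_mem_nhds h0)))
  have hall := Filter.eventually_all.2 hneg
  obtain ⟨t, ht1, ht2⟩ := (hall.and (hct.eventually (eventually_mem_nhds_iff.2 hU))).exists
  have hx : Filter.Tendsto (fun x : ℝ => (x, yb + t • d)) (𝓝 xb) (𝓝 (xb, yb + t • d)) := by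
    have : Continuous (fun x : ℝ => (x, yb + t • d)) := by fun_prop
    exact this.tendsto xb
  have h1 : ∀ᶠ x in 𝓝 xb, ∀ j, g (x, yb + t • d) j < 0 :=
    Filter.eventually_all.2 fun j =>
      hx.eventually ((hgj j).continuous.continuousAt.eventually (gt_mem_nhds (ht1 j)))
  filter_upwards [h1, hx ht2] with x hx1 hx2
  exact ⟨_, hx2, fun j => (hx1 j).le⟩

lemma compact_gap {f : ℝ × EuclideanSpace ℝ (Fin m) → ℝ} (hf : Continuous f) {xb c : ℝ}
    {K : Set (ℝ × EuclideanSpace ℝ (Fin m))} (hK : IsCompact K)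
    (h : ∀ z ∈ K, z.1 = xb → c < f z) :
    ∃ η > 0, ∀ z ∈ K, |z.1 - xb| < η → c + η ≤ f z := by
  have hcont : Continuous (fun z : ℝ × EuclideanSpace ℝ (Fin m) => max |z.1 - xb| (f z - c)) := by
    fun_prop
  obtain ⟨η, hη, h'⟩ := hK.exists_forall_le' hcont.continuousOn (a := 0) (by
    intro z hz
    by_cases hx : z.1 = xb
    · exact lt_max_of_lt_right (by linarith [h z hz hx])
    · exact lt_max_of_lt_left (abs_pos.2 (sub_ne_zero.2 hx)))
  refine ⟨η, hη, fun z hz hlt => ?_⟩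
  rcases le_max_iff.1 (h' z hz) with h1 | h1 <;> linarith

lemma gc_of_localMin {f : ℝ × EuclideanSpace ℝ (Fin m) → ℝ}
    {g : ℝ × EuclideanSpace ℝ (Fin m) → Fin p → ℝ}
    (hf : ContDiff ℝ 3 f) (hg : ContDiff ℝ 3 g) {x : ℝ} {y : EuclideanSpace ℝ (Fin m)}
    (hy : y ∈ Yset g x) (hmin : ∀ᶠ y' in 𝓝 y, y' ∈ Yset g x → f (x, y) ≤ f (x, y')) :
    gcPoint f g x y := by
  classical
  refine ⟨hy, ?_⟩
  have hgj : ∀ j, ContDiff ℝ 3 (fun z => g z j) := fun j => contDiff_pi.1 hg j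
  have hcx : ContDiff ℝ 3 (fun y' : EuclideanSpace ℝ (Fin m) => (x, y')) := by fun_prop
  have strict : ∀ h : ℝ × EuclideanSpace ℝ (Fin m) → ℝ, ContDiff ℝ 3 h →
      HasStrictFDerivAt (fun y' => h (x, y'))
        (InnerProductSpace.toDual ℝ _ (gradY h x y)) y := by
    intro h hh
    rw [gradY, toDual_gradient]
    exact (hh.comp hcx).contDiffAt.hasStrictFDerivAt (by norm_num)
  have hin : ∀ j, ∀ᶠ y' in 𝓝 y, g (x, y) j ≠ 0 → g (x, y') j ≤ 0 := by
    intro j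
    by_cases h0 : g (x, y) j = 0
    · simp [h0]
    · have : g (x, y) j < 0 := lt_of_le_of_ne (hy j) h0
      have hc : Continuous (fun y' => g (x, y') j) := ((hgj j).comp hcx).continuous
      filter_upwards [hc.continuousAt.eventually (gt_mem_nhds this)] with y' hy' _
      exact hy'.le
  have hextr : IsLocalExtrOn (fun y' => f (x, y'))
      {y' | ∀ i : {j : Fin p // g (x, y) j = 0}, g (x, y') i.1 = g (x, y) i.1} y := by
    left
    have := (hmin.and (Filter.eventually_all.2 hin)).filter_mono
      (nhdsWithin_le_nhds (s := {y' | ∀ i : {j : Fin p // g (x, y) j = 0},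
        g (x, y') i.1 = g (x, y) i.1}))
    filter_upwards [this, self_mem_nhdsWithin] with y' hy' hmem
    apply hy'.1
    intro j
    by_cases h0 : g (x, y) j = 0
    · exact ((hmem ⟨j, h0⟩).trans h0).le
    · exact hy'.2 j h0
  obtain ⟨Λ, Λ₀, hne, hsum⟩ := hextr.exists_multipliers_of_hasStrictFDerivAt
    (f := fun (i : {j : Fin p // g (x, y) j = 0}) y' => g (x, y') i.1)
    (fun i => strict _ (hgj i.1)) (strict f hf)
  refine ⟨Λ₀, fun j => if h : g (x, y) j = 0 then Λ ⟨j, h⟩ else 0, ?_, ?_, ?_⟩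
  · intro h
    apply hne
    rw [Prod.mk_eq_zero] at h ⊢
    refine ⟨?_, h.1⟩
    funext i
    have := congrFun h.2 i.1
    simpa [i.2] using this
  · intro j hj
    simp [hj]
  · have e : ∑ j, (if h : g (x, y) j = 0 then Λ ⟨j, h⟩ else 0) • gradYg g x y j =
        ∑ i : {j : Fin p // g (x, y) j = 0}, Λ i • gradYg g x y i.1 := by
      rw [sum_sub (P := fun j => g (x, y) j = 0) (gradYg g x y) (fun j hj => by simp [hj])]
      refine Finset.sum_congr rfl fun i _ => ?_
      simp [i.2]
    rw [e]
    apply (InnerProductSpace.toDual ℝ (EuclideanSpace ℝ (Fin m))).injective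
    rw [map_zero, ← hsum, add_comm, map_add, map_sum]
    simp [gradYg_eq]

lemma curve_gc {f : ℝ × EuclideanSpace ℝ (Fin m) → ℝ}
    {g : ℝ × EuclideanSpace ℝ (Fin m) → Fin p → ℝ}
    (hf : ContDiff ℝ 3 f) (hg : ContDiff ℝ 3 g) {xb : ℝ} {yb yo : EuclideanSpace ℝ (Fin m)}
    (hne : yb ≠ yo) (hS : Sset f g xb = {yb, yo})
    (hLICQ : LinearIndependent ℝ
      (fun j : {j : Fin p // g (xb, yb) j = 0} => gradYg g xb yb j.1))
    {U : Set (ℝ × EuclideanSpace ℝ (Fin m))} (hU : U ∈ 𝓝 (xb, yb))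
    {c : ℝ → EuclideanSpace ℝ (Fin m)}
    (hloc : ∀ z ∈ U, gcPoint f g z.1 z.2 → z.2 = c z.1) :
    ∀ᶠ x in 𝓝 xb, gcPoint f g x (c x) := by
  have hyS : yb ∈ Sset f g xb := by rw [hS]; simp
  obtain ⟨r, hr, hrU⟩ := Metric.mem_nhds_iff.1 hU
  have hdist : 0 < dist yo yb := dist_pos.2 hne.symm
  obtain ⟨ε, hε, hε2⟩ := exists_between (lt_min hr hdist)
  have hεr := hε2.trans_le (min_le_left _ _)
  have hεd := hε2.trans_le (min_le_right _ _)
  have hgc : ∀ j, Continuous (fun z => g z j) := fun j => (contDiff_pi.1 hg j).continuous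
  have hclosed : IsClosed {z : ℝ × EuclideanSpace ℝ (Fin m) | ∀ j, g z j ≤ 0} := by
    rw [Set.ofPred_forall]
    exact isClosed_iInter fun j => isClosed_le (hgc j) continuous_const
  have hK : IsCompact ((Metric.closedBall xb 1 ×ˢ Metric.sphere yb ε) ∩
      {z : ℝ × EuclideanSpace ℝ (Fin m) | ∀ j, g z j ≤ 0}) :=
    ((isCompact_closedBall xb 1).prod (isCompact_sphere yb ε)).inter_right hclosed
  obtain ⟨η, hη, hgap⟩ := compact_gap (c := f (xb, yb)) (xb := xb) hf.continuous hK (by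
    rintro ⟨x, y⟩ ⟨⟨_, hz1⟩, hz2⟩ hx
    simp only at hx hz1
    subst hx
    by_contra hcon
    push Not at hcon
    have : y ∈ Sset f g x := ⟨hz2, fun y' hy' => hcon.trans (hyS.2 y' hy')⟩
    rw [hS] at this
    rcases this with h | h
    · rw [h] at hz1; simp at hz1; exact hε.ne hz1
    · rw [h] at hz1; exact hεd.ne' hz1)
  have hV : {z : ℝ × EuclideanSpace ℝ (Fin m) | f z < f (xb, yb) + η ∧ dist z.2 yb < ε} ∈
      𝓝 (xb, yb) := by
    apply Filter.inter_mem
    · exact hf.continuous.continuousAt.eventually (gt_mem_nhds (by simpa using hη))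
    · have : Continuous (fun z : ℝ × EuclideanSpace ℝ (Fin m) => dist z.2 yb) := by fun_prop
      exact this.continuousAt.eventually (gt_mem_nhds (by simpa using hε))
  filter_upwards [exists_feasible hg hyS.1 hLICQ hV, Metric.ball_mem_nhds xb hη,
    Metric.ball_mem_nhds xb one_pos, Metric.ball_mem_nhds xb hr] with x ⟨y0, ⟨hy0f, hy0d⟩, hy0Y⟩ hxη hx1 hxr
  have hcx : Continuous (fun y : EuclideanSpace ℝ (Fin m) => (x, y)) := by fun_prop
  have hcomp : IsCompact (Metric.closedBall yb ε ∩ Yset g x) :=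
    (isCompact_closedBall yb ε).inter_right (hclosed.preimage hcx)
  obtain ⟨y, ⟨hyb, hyY⟩, hymin⟩ := hcomp.exists_isMinOn ⟨y0, le_of_lt hy0d, hy0Y⟩
    (hf.continuous.comp hcx).continuousOn
  have hyf : f (x, y) ≤ f (x, y0) := hymin ⟨le_of_lt hy0d, hy0Y⟩
  have hlt : dist y yb < ε := by
    apply lt_of_le_of_ne hyb
    intro heq
    have := hgap (x, y) ⟨⟨Metric.ball_subset_closedBall hx1, heq⟩, hyY⟩
      (by simpa [Real.dist_eq] using hxη)
    linarith
  have hgcp : gcPoint f g x y := by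
    apply gc_of_localMin hf hg hyY
    filter_upwards [Metric.isOpen_ball.mem_nhds (show y ∈ Metric.ball yb ε from hlt)] with y' hy' hY'
    exact hymin ⟨Metric.ball_subset_closedBall hy', hY'⟩
  have : y = c x := hloc (x, y) (hrU (by
    rw [Metric.mem_ball, Prod.dist_eq]
    exact max_lt hxr (hlt.trans hεr))) hgcp
  rwa [← this]

lemma sol_exists {f : ℝ × EuclideanSpace ℝ (Fin m) → ℝ}
    {g : ℝ × EuclideanSpace ℝ (Fin m) → Fin p → ℝ}
    (hf : ContDiff ℝ 3 f) (hg : ContDiff ℝ 3 g) {xb : ℝ} {yb yo : EuclideanSpace ℝ (Fin m)}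
    (hIC : ∀ c : ℝ, IsCompact {z : ℝ × EuclideanSpace ℝ (Fin m) |
      |z.1 - xb| ≤ 1 ∧ f z ≤ c ∧ ∀ j, g z j ≤ 0})
    (hS : Sset f g xb = {yb, yo})
    (hLICQ : LinearIndependent ℝ
      (fun j : {j : Fin p // g (xb, yb) j = 0} => gradYg g xb yb j.1))
    {U1 U2 : Set (ℝ × EuclideanSpace ℝ (Fin m))} (hU1 : U1 ∈ 𝓝 (xb, yb)) (hU2 : U2 ∈ 𝓝 (xb, yo))
    {y1 y2 : ℝ → EuclideanSpace ℝ (Fin m)}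
    (hloc1 : ∀ z ∈ U1, gcPoint f g z.1 z.2 → z.2 = y1 z.1)
    (hloc2 : ∀ z ∈ U2, gcPoint f g z.1 z.2 → z.2 = y2 z.1) :
    ∀ᶠ x in 𝓝 xb, y1 x ∈ Sset f g x ∨ y2 x ∈ Sset f g x := by
  have hyS : yb ∈ Sset f g xb := by rw [hS]; simp
  have hK := hIC (f (xb, yb) + 1)
  have hK' := hK.diff (isOpen_interior (s := U1) |>.union (isOpen_interior (s := U2)))
  obtain ⟨η, hη, hgap⟩ := compact_gap (c := f (xb, yb)) (xb := xb) hf.continuous hK' (by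
    rintro ⟨x, y⟩ ⟨⟨_, _, hz2⟩, hz3⟩ hx
    simp only at hx
    subst hx
    by_contra hcon
    push Not at hcon
    have : y ∈ Sset f g x := ⟨hz2, fun y' hy' => hcon.trans (hyS.2 y' hy')⟩
    rw [hS] at this
    rcases this with h | h
    · rw [h] at hz3; exact hz3 (Or.inl (mem_interior_iff_mem_nhds.2 hU1))
    · rw [h] at hz3; exact hz3 (Or.inr (mem_interior_iff_mem_nhds.2 hU2)))
  have hV : {z : ℝ × EuclideanSpace ℝ (Fin m) | f z < f (xb, yb) + min η 1} ∈ 𝓝 (xb, yb) :=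
    hf.continuous.continuousAt.eventually (gt_mem_nhds (by simpa using hη))
  filter_upwards [exists_feasible hg hyS.1 hLICQ hV, Metric.ball_mem_nhds xb hη,
    Metric.ball_mem_nhds xb one_pos] with x ⟨y0, hy0f, hy0Y⟩ hxη hx1
  have hy0f' : f (x, y0) < f (xb, yb) + min η 1 := hy0f
  have hx1' : |x - xb| ≤ 1 := by
    have : dist x xb < 1 := hx1
    rw [Real.dist_eq] at this; exact this.le
  have hm1 := min_le_left η 1
  have hm2 := min_le_right η 1
  have hcx : Continuous (fun y : EuclideanSpace ℝ (Fin m) => (x, y)) := by fun_prop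
  obtain ⟨⟨x', y⟩, ⟨⟨hz1, hz2, hz3⟩, hx'⟩, hmin⟩ :=
    (hK.inter_right (isClosed_singleton (x := x) |>.preimage continuous_fst)).exists_isMinOn
    ⟨(x, y0), ⟨hx1', by linarith, hy0Y⟩, rfl⟩ hf.continuous.continuousOn
  have hx'' : x' = x := hx'
  subst hx''
  have hySx : y ∈ Sset f g x' := by
    refine ⟨hz3, fun y' hy' => ?_⟩
    by_cases hc : f (x', y') ≤ f (xb, yb) + 1
    · exact hmin (show (x', y') ∈ _ from ⟨⟨hx1', hc, hy'⟩, rfl⟩)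
    · push Not at hc
      exact hz2.trans hc.le
  have hgcp : gcPoint f g x' y :=
    gc_of_localMin hf hg hySx.1 (Filter.Eventually.of_forall hySx.2)
  have hO : (x', y) ∈ interior U1 ∪ interior U2 := by
    by_contra hO
    have := hgap (x', y) ⟨⟨hz1, hz2, hz3⟩, hO⟩ (by simpa [Real.dist_eq] using hxη)
    have := hySx.2 y0 hy0Y
    linarith
  rcases hO with h | h
  · left
    have := hloc1 _ (interior_subset h) hgcp
    simp only at this
    rwa [← this]
  · right
    have := hloc2 _ (interior_subset h) hgcp
    simp only at this
    rwa [← this]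

end helpers2

section helpers3
variable {m p : ℕ}

lemma slope_sign {D φ : ℝ → ℝ} {α φ' xb : ℝ} (hD : HasDerivAt D α xb) (hφ : HasDerivAt φ φ' xb)
    (hD0 : D xb = 0) (h : ∀ᶠ x in 𝓝 xb, 0 < D x → φ xb ≤ φ x) (hα : α ≠ 0) : 0 ≤ φ' / α := by
  have sD := hD.tendsto_slope
  have sφ := hφ.tendsto_slope
  rcases lt_or_gt_of_ne hα with ha | ha
  · have hle : 𝓝[<] xb ≤ 𝓝[≠] xb := nhdsWithin_mono _ (fun t (ht : t < xb) => ht.ne)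
    have h1 := (sD.mono_left hle).eventually (gt_mem_nhds ha)
    have : φ' ≤ 0 := by
      apply le_of_tendsto (sφ.mono_left hle)
      filter_upwards [h1, h.filter_mono nhdsWithin_le_nhds, self_mem_nhdsWithin] with x hx1 hx2 hx3
      have hx3' : x < xb := hx3
      rw [slope_def_field, hD0, sub_zero] at hx1
      have hDx : 0 < D x := by
        rcases div_neg_iff.1 hx1 with h | h
        · exact h.1
        · linarith [h.2]
      rw [slope_def_field]
      exact div_nonpos_of_nonneg_of_nonpos (by linarith [hx2 hDx]) (by linarith)
    exact div_nonneg_of_nonpos this ha.le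
  · have hle : 𝓝[>] xb ≤ 𝓝[≠] xb := nhdsWithin_mono _ (fun t (ht : xb < t) => ht.ne')
    have h1 := (sD.mono_left hle).eventually (lt_mem_nhds ha)
    have : 0 ≤ φ' := by
      apply ge_of_tendsto (sφ.mono_left hle)
      filter_upwards [h1, h.filter_mono nhdsWithin_le_nhds, self_mem_nhdsWithin] with x hx1 hx2 hx3
      have hx3' : xb < x := hx3
      rw [slope_def_field, hD0, sub_zero] at hx1
      have hDx : 0 < D x := by
        rcases div_pos_iff.1 hx1 with h | h
        · exact h.1
        · linarith [h.2]
      rw [slope_def_field]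
      exact div_nonneg (by linarith [hx2 hDx]) (by linarith)
    exact div_nonneg this ha.le

lemma tangent_eq {f : ℝ × EuclideanSpace ℝ (Fin m) → ℝ}
    {g : ℝ × EuclideanSpace ℝ (Fin m) → Fin p → ℝ}
    (hf : ContDiff ℝ 3 f) (hg : ContDiff ℝ 3 g) {xb : ℝ} {yb : EuclideanSpace ℝ (Fin m)}
    (u : Fin p → ℝ) (husupp : ∀ j, g (xb, yb) j ≠ 0 → u j = 0)
    (hLICQ : LinearIndependent ℝ
      (fun j : {j : Fin p // g (xb, yb) j = 0} => gradYg g xb yb j.1))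
    (hstat : gradY f xb yb + ∑ j, u j • gradYg g xb yb j = 0)
    {c : ℝ → EuclideanSpace ℝ (Fin m)} {c' : EuclideanSpace ℝ (Fin m)}
    (hc : HasDerivAt c c' xb) (hcb : c xb = yb)
    (hgc : ∀ᶠ x in 𝓝 xb, gcPoint f g x (c x))
    (v : EuclideanSpace ℝ (Fin m)) (hv : ∀ j, g (xb, yb) j = 0 → ⟪gradYg g xb yb j, v⟫ = 0) :
    ⟪LagMix f g u xb yb, v⟫ + ⟪LagYY f g u xb yb c', v⟫ = 0 := by
  classical
  subst hcb
  have hfd : Differentiable ℝ f := hf.differentiable (by norm_num)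
  have hgd : Differentiable ℝ g := hg.differentiable (by norm_num)
  have hgj : ∀ j, ContDiff ℝ 3 (fun z => g z j) := fun j => contDiff_pi.1 hg j
  have hL2 := contDiff_gradY ((Lag_contDiff hf hg u).of_le (by norm_num : (2 : WithTop ℕ∞) ≤ 3))
  have hcurve : HasDerivAt (fun x => (x, c x)) ((1 : ℝ), c') xb := (hasDerivAt_id xb).prodMk hc
  let Φ : ℝ → EuclideanSpace ℝ (Fin m) := fun x => gradY (Lag f g u) x (c x)
  have hΦ : HasDerivAt Φ (LagMix f g u xb (c xb) + LagYY f g u xb (c xb) c') xb := by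
    rw [LagMix_eq hf hg, LagYY_apply hf hg, ← map_add]
    have e : ((1 : ℝ), (0 : EuclideanSpace ℝ (Fin m))) + (0, c') = (1, c') := by simp
    rw [e]
    exact (hL2.differentiable (by norm_num) (xb, c xb)).hasFDerivAt.comp_hasDerivAt xb hcurve
  have hΦ0 : Φ xb = 0 := by
    simp only [Φ]
    rw [gradY_Lag hfd hgd, hstat]
  let A : ℝ → ({j : Fin p // g (xb, c xb) j = 0} → ℝ) →L[ℝ] EuclideanSpace ℝ (Fin m) := fun x =>
    ∑ j : {j : Fin p // g (xb, c xb) j = 0},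
      (ContinuousLinearMap.proj (R := ℝ) (φ := fun _ : {j : Fin p // g (xb, c xb) j = 0} => ℝ) j).smulRight (gradYg g x (c x) j.1)
  have hA : ∀ x q, A x q = ∑ j, q j • gradYg g x (c x) j.1 := by
    intro x q
    simp [A, sum_apply]
  have hAc : ContinuousAt A xb := by
    refine tendsto_finsetSum _ fun j _ => ?_
    have h1 : ContinuousAt (fun x => gradYg g x (c x) j.1) xb :=
      ((contDiff_gradY ((hgj j.1).of_le (by norm_num))).continuous.continuousAt
        (x := (xb, c xb))).comp (f := fun x => (x, c x)) hcurve.continuousAt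
    exact (((ContinuousLinearMap.smulRightL ℝ _ _ (ContinuousLinearMap.proj (R := ℝ) (φ := fun _ : {j : Fin p // g (xb, c xb) j = 0} => ℝ) j)).continuous.continuousAt).comp h1)
  obtain ⟨K, hK, hanti⟩ := (A xb).toLinearMap.exists_antilipschitzWith (by
    rw [LinearMap.ker_eq_bot']
    intro q hq
    have hq' : A xb q = 0 := hq
    rw [hA] at hq'
    funext j
    exact (Fintype.linearIndependent_iff.1 hLICQ) q hq' j)
  have hK0 : (0 : ℝ) < K := hK
  have hbd0 : ∀ q, ‖q‖ ≤ K * ‖A xb q‖ := by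
    intro q
    have := hanti.le_mul_dist q 0
    simpa using this
  have hclose : ∀ᶠ x in 𝓝 xb, ‖A x - A xb‖ < 1 / (2 * K) := by
    have : Filter.Tendsto (fun x => ‖A x - A xb‖) (𝓝 xb) (𝓝 0) := by
      have := (hAc.sub (continuousAt_const (y := A xb))).norm
      have h2 := this.tendsto
      simpa using h2
    exact this.eventually (gt_mem_nhds (by positivity))
  have hin : ∀ᶠ x in 𝓝 xb, ∀ j, g (xb, c xb) j ≠ 0 → g (x, c x) j ≠ 0 := by
    refine Filter.eventually_all.2 fun j => ?_
    by_cases h0 : g (xb, c xb) j = 0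
    · simp [h0]
    · have h1 : ContinuousAt (fun x => g (x, c x) j) xb :=
        ((hgj j).continuous.continuousAt (x := (xb, c xb))).comp (f := fun x => (x, c x))
          hcurve.continuousAt
      filter_upwards [h1.eventually_ne h0] with x hx _ using hx
  have key : ∀ᶠ x in 𝓝 xb, |⟪Φ x, v⟫| ≤ (2 * K * ‖v‖) * (‖A x - A xb‖ * ‖Φ x‖) := by
    filter_upwards [hgc, hclose, hin] with x hx hxc hxin
    have hbd : ∀ q, ‖q‖ ≤ 2 * K * ‖A x q‖ := by
      intro q
      have h1 := hbd0 q
      have h2 : ‖A xb q‖ ≤ ‖A x q‖ + ‖A x - A xb‖ * ‖q‖ := by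
        have e : A xb q = A x q - (A x - A xb) q := by simp
        rw [e]
        exact (norm_sub_le _ _).trans (by gcongr; exact (A x - A xb).le_opNorm q)
      have h3 : ‖A x - A xb‖ * ‖q‖ ≤ 1 / (2 * K) * ‖q‖ := by gcongr
      have h4 : K * (‖A x q‖ + 1 / (2 * K) * ‖q‖) = K * ‖A x q‖ + ‖q‖ / 2 := by
        field_simp
      have h5 : K * ‖A xb q‖ ≤ K * (‖A x q‖ + 1 / (2 * K) * ‖q‖) := by gcongr; linarith
      linarith
    obtain ⟨_, u₀, w, hne, hsupp, hsum⟩ := hx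
    have hwsupp : ∀ j, ¬ g (xb, c xb) j = 0 → w j = 0 := fun j hj => hsupp j (hxin j hj)
    rw [sum_sub (P := fun j => g (xb, c xb) j = 0) _ hwsupp] at hsum
    have hAw := hA x (fun j => w j.1)
    have hu0 : u₀ ≠ 0 := by
      intro h0
      rw [h0, zero_smul, zero_add, ← hAw] at hsum
      have h1 := hbd (fun j => w j.1)
      rw [hsum, norm_zero, mul_zero] at h1
      have h2 := norm_le_zero_iff.1 h1
      apply hne
      rw [Prod.mk_eq_zero]
      refine ⟨h0, ?_⟩
      funext j
      by_cases hj : g (xb, c xb) j = 0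
      · exact congrFun h2 ⟨j, hj⟩
      · exact hwsupp j hj
    have hAu := hA x (fun j => u j.1)
    let q : {j : Fin p // g (xb, c xb) j = 0} → ℝ := (fun j => u j.1) - u₀⁻¹ • (fun j => w j.1)
    have hΦq : Φ x = A x q := by
      simp only [Φ, q]
      rw [gradY_Lag hfd hgd, sum_sub (P := fun j => g (xb, c xb) j = 0) _ husupp, ← hAu,
        map_sub, map_smul]
      rw [← hAw] at hsum
      have : gradY f x (c x) = - (u₀⁻¹ • A x (fun j => w j.1)) := by
        rw [← sub_eq_zero, sub_neg_eq_add]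
        have h := congrArg (fun t => u₀⁻¹ • t) hsum
        simpa [smul_add, smul_smul, hu0] using h
      rw [this]; abel
    have h0 : ⟪A xb q, v⟫ = 0 := by
      rw [hA, sum_inner]
      refine Finset.sum_eq_zero fun j _ => ?_
      rw [inner_smul_left, hv j.1 j.2, mul_zero]
    have e : ⟪Φ x, v⟫ = ⟪(A x - A xb) q, v⟫ := by
      rw [hΦq, sub_apply, inner_sub_left, h0, sub_zero]
    have hq := hbd q
    rw [← hΦq] at hq
    rw [e]
    calc |⟪(A x - A xb) q, v⟫| ≤ ‖(A x - A xb) q‖ * ‖v‖ := abs_real_inner_le_norm _ _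
      _ ≤ (‖A x - A xb‖ * ‖q‖) * ‖v‖ := by gcongr; exact (A x - A xb).le_opNorm q
      _ ≤ (‖A x - A xb‖ * (2 * K * ‖Φ x‖)) * ‖v‖ := by gcongr
      _ = _ := by ring
  have hO1 : (fun x => ⟪Φ x, v⟫) =O[𝓝 xb] (fun x => ‖A x - A xb‖ * ‖Φ x‖) := by
    apply Asymptotics.IsBigO.of_bound (2 * K * ‖v‖)
    filter_upwards [key] with x hx
    rw [Real.norm_eq_abs]
    refine hx.trans (le_of_eq ?_)
    rw [Real.norm_of_nonneg (by positivity)]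
  have hO2 : (fun x => ‖A x - A xb‖ * ‖Φ x‖) =o[𝓝 xb] (fun x => (1 : ℝ) * (x - xb)) := by
    apply Asymptotics.IsLittleO.mul_isBigO
    · rw [Asymptotics.isLittleO_one_iff]
      have := (hAc.sub (continuousAt_const (y := A xb))).norm.tendsto
      simpa using this
    · have := hΦ.isBigO_sub
      simp only [hΦ0, sub_zero] at this
      exact this.norm_left
  have hd0 : HasDerivAt (fun x => ⟪Φ x, v⟫) 0 xb := by
    rw [hasDerivAt_iff_isLittleO]
    simp only [hΦ0, inner_zero_left, sub_zero, smul_zero]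
    simpa using hO1.trans_isLittleO hO2
  have hd1 := hΦ.inner ℝ (hasDerivAt_const xb v)
  have := hd1.unique hd0
  rw [inner_zero_right, zero_add, inner_add_left] at this
  exact this

end helpers3

section helpers4
variable {m p : ℕ}

lemma active_deriv {f : ℝ × EuclideanSpace ℝ (Fin m) → ℝ}
    {g : ℝ × EuclideanSpace ℝ (Fin m) → Fin p → ℝ}
    (hg : ContDiff ℝ 3 g) {xb : ℝ}
    {c : ℝ → EuclideanSpace ℝ (Fin m)} {c' : EuclideanSpace ℝ (Fin m)}
    (hc : HasDerivAt c c' xb)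
    (hgc : ∀ᶠ x in 𝓝 xb, gcPoint f g x (c x)) (j : Fin p) (hj : g (xb, c xb) j = 0) :
    deriv (fun x => g (x, c xb) j) xb + ⟪gradYg g xb (c xb) j, c'⟫ = 0 := by
  have h1 := hasDerivAt_curve (h := fun z => g z j) hc
    ((contDiff_pi.1 hg j).differentiable (by norm_num) _)
  refine IsLocalMax.hasDerivAt_eq_zero (f := fun x => g (x, c x) j) ?_ h1
  filter_upwards [hgc] with x hx
  rw [hj]
  exact hx.1 j

lemma envelope {f : ℝ × EuclideanSpace ℝ (Fin m) → ℝ}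
    {g : ℝ × EuclideanSpace ℝ (Fin m) → Fin p → ℝ}
    (hf : ContDiff ℝ 3 f) (hg : ContDiff ℝ 3 g) {xb : ℝ}
    {c : ℝ → EuclideanSpace ℝ (Fin m)} {c' : EuclideanSpace ℝ (Fin m)}
    (u : Fin p → ℝ) (husupp : ∀ j, g (xb, c xb) j ≠ 0 → u j = 0)
    (hstat : gradY f xb (c xb) + ∑ j, u j • gradYg g xb (c xb) j = 0)
    (hc : HasDerivAt c c' xb)
    (hgc : ∀ᶠ x in 𝓝 xb, gcPoint f g x (c x)) :
    HasDerivAt (fun x => f (x, c x)) (deriv (fun x => f (x, c xb)) xb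
      + ∑ j, u j * deriv (fun x => g (x, c xb) j) xb) xb := by
  have h1 := hasDerivAt_curve (h := f) hc (hf.differentiable (by norm_num) _)
  convert h1 using 2
  rw [eq_neg_of_add_eq_zero_left hstat, inner_neg_left, sum_inner, ← Finset.sum_neg_distrib]
  refine Finset.sum_congr rfl fun j _ => ?_
  rw [inner_smul_left]
  by_cases hj : g (xb, c xb) j = 0
  · have := active_deriv hg hc hgc j hj
    have e := eq_neg_of_add_eq_zero_left this
    rw [e]; simp
  · rw [husupp j hj]; simp

end helpers4

theorem statement15 {m p : ℕ}
    (F f : ℝ × EuclideanSpace ℝ (Fin m) → ℝ)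
    (g : ℝ × EuclideanSpace ℝ (Fin m) → Fin p → ℝ)
    (hF : ContDiff ℝ 1 F) (hf : ContDiff ℝ 3 f) (hg : ContDiff ℝ 3 g)
    (xbar : ℝ) (ybar1 ybar2 : EuclideanSpace ℝ (Fin m)) (hne : ybar1 ≠ ybar2)
    -- inf-compactness at x̄
    (hIC : ∀ c : ℝ, IsCompact {z : ℝ × EuclideanSpace ℝ (Fin m) |
      |z.1 - xbar| ≤ 1 ∧ f z ≤ c ∧ ∀ j, g z j ≤ 0})
    -- S(x̄) = {ȳ₁, ȳ₂}
    (hS : Sset f g xbar = {ybar1, ybar2})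
    -- (x̄,ȳ₁) is a local minimizer of the bilevel program (no upper-level constraints)
    (hlocal : ∃ U ∈ 𝓝 (xbar, ybar1), ∀ z ∈ U, z.2 ∈ Sset f g z.1 →
      F (xbar, ybar1) ≤ F z)
    -- multipliers ū¹, ū² at ȳ₁, ȳ₂ (extended by zero outside the active sets),
    -- each ȳ_k a nondegenerate critical point with positive multipliers
    (ubar1 ubar2 : Fin p → ℝ)
    (husupp1 : ∀ j, g (xbar, ybar1) j ≠ 0 → ubar1 j = 0)
    (husupp2 : ∀ j, g (xbar, ybar2) j ≠ 0 → ubar2 j = 0)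
    (hLICQ1 : LinearIndependent ℝ
      (fun j : {j : Fin p // g (xbar, ybar1) j = 0} => gradYg g xbar ybar1 j.1))
    (hLICQ2 : LinearIndependent ℝ
      (fun j : {j : Fin p // g (xbar, ybar2) j = 0} => gradYg g xbar ybar2 j.1))
    (hstat1 : gradY f xbar ybar1 + ∑ j, ubar1 j • gradYg g xbar ybar1 j = 0)
    (hstat2 : gradY f xbar ybar2 + ∑ j, ubar2 j • gradYg g xbar ybar2 j = 0)
    (hpos1 : ∀ j, g (xbar, ybar1) j = 0 → 0 < ubar1 j)
    (hpos2 : ∀ j, g (xbar, ybar2) j = 0 → 0 < ubar2 j)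
    (hSOC1 : ∀ w : EuclideanSpace ℝ (Fin m),
      (∀ j, g (xbar, ybar1) j = 0 → ⟪gradYg g xbar ybar1 j, w⟫ = 0) →
      (∀ v : EuclideanSpace ℝ (Fin m),
        (∀ j, g (xbar, ybar1) j = 0 → ⟪gradYg g xbar ybar1 j, v⟫ = 0) →
        ⟪LagYY f g ubar1 xbar ybar1 w, v⟫ = 0) →
      w = 0)
    (hSOC2 : ∀ w : EuclideanSpace ℝ (Fin m),
      (∀ j, g (xbar, ybar2) j = 0 → ⟪gradYg g xbar ybar2 j, w⟫ = 0) →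
      (∀ v : EuclideanSpace ℝ (Fin m),
        (∀ j, g (xbar, ybar2) j = 0 → ⟪gradYg g xbar ybar2 j, v⟫ = 0) →
        ⟪LagYY f g ubar2 xbar ybar2 w, v⟫ = 0) →
      w = 0)
    -- the local C² curves of generalized critical points through ȳ₁ and ȳ₂
    (N : Set ℝ) (hN : N ∈ 𝓝 xbar)
    (y1 y2 : ℝ → EuclideanSpace ℝ (Fin m))
    (hy1c : ContDiffOn ℝ 2 y1 N) (hy2c : ContDiffOn ℝ 2 y2 N)
    (hy1bar : y1 xbar = ybar1) (hy2bar : y2 xbar = ybar2)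
    (U1 : Set (ℝ × EuclideanSpace ℝ (Fin m))) (hU1 : U1 ∈ 𝓝 (xbar, ybar1))
    (U2 : Set (ℝ × EuclideanSpace ℝ (Fin m))) (hU2 : U2 ∈ 𝓝 (xbar, ybar2))
    (hloc1 : ∀ z ∈ U1, gcPoint f g z.1 z.2 → z.2 = y1 z.1)
    (hloc2 : ∀ z ∈ U2, gcPoint f g z.1 z.2 → z.2 = y2 z.1)
    -- α ≠ 0
    (hα : deriv (fun x => f (x, y2 x) - f (x, y1 x)) xbar ≠ 0) :
    ∃ (lam1 lam2 : ℝ) (w : EuclideanSpace ℝ (Fin m)) (ξ : Fin p → ℝ) (μ : ℝ),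
      0 ≤ lam1 ∧ 0 ≤ lam2 ∧ lam1 + lam2 = 1 ∧ 0 < μ ∧
      0 = deriv (fun x => F (x, ybar1)) xbar
          + μ * (lam1 * (deriv (fun x => f (x, ybar1)) xbar
                          - deriv (fun x => f (x, ybar1)) xbar
                          - ∑ j, ubar1 j * deriv (fun x => g (x, ybar1) j) xbar)
                 + lam2 * (deriv (fun x => f (x, ybar1)) xbar
                          - deriv (fun x => f (x, ybar2)) xbar
                          - ∑ j, ubar2 j * deriv (fun x => g (x, ybar2) j) xbar))
          - ⟪LagMix f g ubar1 xbar ybar1, w⟫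
          + deriv (fun x => ∑ i, ξ i * g (x, ybar1) i) xbar ∧
      (0 : EuclideanSpace ℝ (Fin m))
        = gradY F xbar ybar1 + μ • gradY f xbar ybar1
          - LagYY f g ubar1 xbar ybar1 w
          + gradY (fun z => ∑ i, ξ i * g z i) xbar ybar1 ∧
      (∀ i, g (xbar, ybar1) i ≠ 0 → ξ i = 0) ∧
      (∀ j, g (xbar, ybar1) j = 0 → ⟪gradYg g xbar ybar1 j, w⟫ = 0) := by
  classical
  subst hy1bar hy2bar
  have hfd : Differentiable ℝ f := hf.differentiable (by norm_num)
  have hgd : Differentiable ℝ g := hg.differentiable (by norm_num)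
  have hFd : Differentiable ℝ F := hF.differentiable (by norm_num)
  have hS1 : y1 xbar ∈ Sset f g xbar := by rw [hS]; simp
  have hS2 : y2 xbar ∈ Sset f g xbar := by rw [hS]; simp
  have hS' : Sset f g xbar = {y2 xbar, y1 xbar} := by rw [hS, Set.pair_comm]
  have hgc1 := curve_gc hf hg hne hS hLICQ1 hU1 hloc1
  have hgc2 := curve_gc hf hg hne.symm hS' hLICQ2 hU2 hloc2
  have hsol := sol_exists hf hg hIC hS hLICQ1 hU1 hU2 hloc1 hloc2
  have hc1 : HasDerivAt y1 (deriv y1 xbar) xbar :=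
    ((hy1c.contDiffAt hN).differentiableAt (by norm_num)).hasDerivAt
  have hc2 : HasDerivAt y2 (deriv y2 xbar) xbar :=
    ((hy2c.contDiffAt hN).differentiableAt (by norm_num)).hasDerivAt
  have he1 := envelope hf hg ubar1 husupp1 hstat1 hc1 hgc1
  have he2 := envelope hf hg ubar2 husupp2 hstat2 hc2 hgc2
  have hD := he2.sub he1
  have hφ := hasDerivAt_curve (h := F) hc1 (hFd _)
  have hαe := hD.deriv
  change deriv (fun x => f (x, y2 x) - f (x, y1 x)) xbar = _ at hαe
  obtain ⟨w, ξ0, hw, hwξ⟩ := solve_w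
    (fun j : {j : Fin p // g (xbar, y1 xbar) j = 0} => gradYg g xbar (y1 xbar) j.1)
    (LagYY f g ubar1 xbar (y1 xbar))
    (fun w h1 h2 => hSOC1 w (fun j hj => h1 ⟨j, hj⟩)
      (fun v hv => h2 v (fun j => hv j.1 j.2))) (gradY F xbar (y1 xbar))
  have hw' : ∀ j, g (xbar, y1 xbar) j = 0 → ⟪gradYg g xbar (y1 xbar) j, w⟫ = 0 :=
    fun j hj => hw ⟨j, hj⟩
  let η : Fin p → ℝ := fun j => if h : g (xbar, y1 xbar) j = 0 then ξ0 ⟨j, h⟩ else 0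
  have hηs : ∀ j, g (xbar, y1 xbar) j ≠ 0 → η j = 0 := fun j hj => by simp [η, hj]
  have hηsum : ∑ j, η j • gradYg g xbar (y1 xbar) j = ∑ j : {j : Fin p // g (xbar, y1 xbar) j = 0},
      ξ0 j • gradYg g xbar (y1 xbar) j.1 := by
    rw [sum_sub (P := fun j => g (xbar, y1 xbar) j = 0) _ hηs]
    refine Finset.sum_congr rfl fun j _ => ?_
    simp [η, j.2]
  rw [← hηsum] at hwξ
  have htan := tangent_eq hf hg ubar1 husupp1 hLICQ1 hstat1 hc1 rfl hgc1 w hw'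
  rw [LagYY_symm hf hg] at htan
  set φ' := deriv (fun t => F (t, y1 xbar)) xbar + ⟪gradY F xbar (y1 xbar), deriv y1 xbar⟫ with hφ'
  have hsign : 0 ≤ φ' / deriv (fun x => f (x, y2 x) - f (x, y1 x)) xbar := by
    obtain ⟨U, hU, hUm⟩ := hlocal
    refine slope_sign (D := fun x => f (x, y2 x) - f (x, y1 x)) (φ := fun t => F (t, y1 t))
      (by rw [hαe]; exact hD) hφ ?_ ?_ hα
    · have h1 := hS1.2 _ hS2.1
      have h2 := hS2.2 _ hS1.1
      linarith
    · have hcont : Filter.Tendsto (fun x => (x, y1 x)) (𝓝 xbar) (𝓝 (xbar, y1 xbar)) :=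
        ((hasDerivAt_id xbar).prodMk hc1).continuousAt.tendsto
      filter_upwards [hsol, hgc1, hcont hU] with x hx hxg hxU hpos
      have hx1 : y1 x ∈ Sset f g x := by
        rcases hx with h | h
        · exact h
        · have := h.2 (y1 x) hxg.1
          linarith
      exact hUm (x, y1 x) hxU hx1
  set α := deriv (fun x => f (x, y2 x) - f (x, y1 x)) xbar with hαdef
  set ρ := φ' / α with hρ
  have hρα : ρ * α = φ' := by rw [hρ]; field_simp
  have hμ : 0 < ρ + 1 := by linarith
  have hFy : ⟪gradY F xbar (y1 xbar), deriv y1 xbar⟫ =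
      ⟪LagYY f g ubar1 xbar (y1 xbar) w, deriv y1 xbar⟫ +
      ∑ j, η j * deriv (fun x => g (x, y1 xbar) j) xbar := by
    have e : gradY F xbar (y1 xbar) = LagYY f g ubar1 xbar (y1 xbar) w -
        ∑ j, η j • gradYg g xbar (y1 xbar) j := by
      rw [← sub_eq_zero, ← hwξ]; abel
    rw [e, inner_sub_left, sum_inner, sub_eq_add_neg, ← Finset.sum_neg_distrib]
    congr 1
    refine Finset.sum_congr rfl fun j _ => ?_
    rw [inner_smul_left]
    by_cases hj : g (xbar, y1 xbar) j = 0
    · have := active_deriv hg hc1 hgc1 j hj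
      rw [eq_neg_of_add_eq_zero_left this]; simp
    · rw [hηs j hj]; simp
  refine ⟨1 / (ρ + 1), ρ / (ρ + 1), w, fun j => η j + (ρ + 1) * ubar1 j, ρ + 1,
    by positivity, by positivity, by field_simp; ring, hμ, ?_, ?_, ?_, hw'⟩
  · rw [deriv_comb hgd]
    have e1 : ∑ j, (η j + (ρ + 1) * ubar1 j) * deriv (fun x => g (x, y1 xbar) j) xbar =
        ∑ j, η j * deriv (fun x => g (x, y1 xbar) j) xbar +
        (ρ + 1) * ∑ j, ubar1 j * deriv (fun x => g (x, y1 xbar) j) xbar := by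
      rw [Finset.mul_sum, ← Finset.sum_add_distrib]
      refine Finset.sum_congr rfl fun j _ => by ring
    rw [e1]
    rw [hFy] at hφ'
    rw [hαe] at hρα
    generalize (∑ j, ubar1 j * deriv (fun x => g (x, y1 xbar) j) xbar) = G1 at *
    generalize (∑ j, ubar2 j * deriv (fun x => g (x, y2 xbar) j) xbar) = G2 at *
    generalize (∑ j, η j * deriv (fun x => g (x, y1 xbar) j) xbar) = G3 at *
    generalize ⟪LagYY f g ubar1 xbar (y1 xbar) w, deriv y1 xbar⟫ = G4 at *
    generalize ⟪LagMix f g ubar1 xbar (y1 xbar), w⟫ = G5 at *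
    generalize deriv (fun x => f (x, y1 xbar)) xbar = a1 at *
    generalize deriv (fun x => f (x, y2 xbar)) xbar = a2 at *
    generalize deriv (fun x => F (x, y1 xbar)) xbar = b at *
    have e2 : ∀ A B : ℝ, (ρ + 1) * (1 / (ρ + 1) * A + ρ / (ρ + 1) * B) = A + ρ * B := by
      intro A B
      field_simp
    rw [e2]
    linear_combination hρα + hφ' + htan
  · rw [gradY_comb hgd]
    have e1 : ∑ j, (η j + (ρ + 1) * ubar1 j) • gradYg g xbar (y1 xbar) j =
        ∑ j, η j • gradYg g xbar (y1 xbar) j +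
        (ρ + 1) • ∑ j, ubar1 j • gradYg g xbar (y1 xbar) j := by
      rw [Finset.smul_sum, ← Finset.sum_add_distrib]
      refine Finset.sum_congr rfl fun j _ => by rw [add_smul, mul_smul]
    rw [e1, eq_neg_of_add_eq_zero_left hstat1, ← hwξ, smul_neg]
    abel
  · intro i hi
    simp [hηs i hi, husupp1 i hi]
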